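/- arXiv:math/9807114 — 8 statements merged into one kernel-verified Lean document; each statement's English description precedes it below -/
import Mathlib

section
/- Let C be a class of groups closed under isomorphism. If G₁, G₂, and G₁ × G₂ all lie in C, H₁ is a subgroup of G₁, and H₂ is a subgroup of G₂, then dom_{G₁×G₂}^C(H₁ × H₂) = dom_{G₁}^C(H₁) × dom_{G₂}^C(H₂). That is, the dominion construction respects finite direct products. -/
universe u

/-- The dominion of a subset `S` of a group `G` in a class `C` of groups:
the set of elements of `G` on which any two homomorphisms into a group of `C`
agreeing on `S` must agree. -/
def dominion {G : Type u} [Group G] (C : ∀ (K : Type u) [Group K], Prop) (S : Set G) : Set G :=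
  {a | ∀ (K : Type u) [Group K], C K → ∀ f g : G →* K, (∀ x ∈ S, f x = g x) → f a = g a}

/-- Dominions respect finite direct products. -/
theorem dominion_prod {G₁ G₂ : Type u} [Group G₁] [Group G₂]
    (C : ∀ (K : Type u) [Group K], Prop)
    (hiso : ∀ (K L : Type u) [Group K] [Group L], C K → Nonempty (K ≃* L) → C L)
    (hG₁ : C G₁) (hG₂ : C G₂) (hG₁₂ : C (G₁ × G₂))
    (H₁ : Subgroup G₁) (H₂ : Subgroup G₂) :
    dominion C ((H₁.prod H₂ : Subgroup (G₁ × G₂)) : Set (G₁ × G₂)) =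
      (dominion C (H₁ : Set G₁)) ×ˢ (dominion C (H₂ : Set G₂)) := by
  ext ⟨a, b⟩
  constructor
  · intro h
    exact ⟨fun K _ hK f g hfg =>
        h K hK (f.comp (MonoidHom.fst G₁ G₂)) (g.comp (MonoidHom.fst G₁ G₂))
          fun x hx => hfg x.1 hx.1,
      fun K _ hK f g hfg =>
        h K hK (f.comp (MonoidHom.snd G₁ G₂)) (g.comp (MonoidHom.snd G₁ G₂))
          fun x hx => hfg x.2 hx.2⟩
  · rintro ⟨ha, hb⟩ K _ hK f g hfg
    have h₁ : f (a, 1) = g (a, 1) :=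
      ha K hK (f.comp (MonoidHom.inl G₁ G₂)) (g.comp (MonoidHom.inl G₁ G₂))
        fun x hx => hfg (x, 1) ⟨hx, H₂.one_mem⟩
    have h₂ : f (1, b) = g (1, b) :=
      hb K hK (f.comp (MonoidHom.inr G₁ G₂)) (g.comp (MonoidHom.inr G₁ G₂))
        fun x hx => hfg (1, x) ⟨H₁.one_mem, hx⟩
    rw [← Prod.fst_mul_snd (a, b), map_mul, map_mul, h₁, h₂]
end

section
/- Let C be a class of groups closed under isomorphism, under taking subgroups, under taking quotient groups, and under finite direct products. Let G be a group in C, let H be a subgroup of G, and let N be a normal subgroup of G with N ⊆ H. Then dom_{G/N}^C(H/N) = (dom_G^C(H))/N; that is, dominions in C respect quotients. -/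
universe u

/-- A homomorphism maps into the normalizer of the image of any normal subgroup. -/
theorem MonoidHom.apply_mem_normalizer_map {G L : Type*} [Group G] [Group L] (f : G →* L)
    (N : Subgroup G) [N.Normal] (x : G) :
    f x ∈ Subgroup.normalizer (N.map f : Set L) := by
  apply N.le_normalizer_map f
  rw [Subgroup.normalizer_eq_top]
  exact ⟨x, Subgroup.mem_top x, rfl⟩

/-- If C is closed under isomorphism, subgroups, quotients and finite direct products,
then dominions respect quotients. -/
theorem dominion_quotient {G : Type u} [Group G]
    (C : ∀ (K : Type u) [Group K], Prop)
    (hiso : ∀ (K L : Type u) [Group K] [Group L], C K → Nonempty (K ≃* L) → C L)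
    (hsub : ∀ (K : Type u) [Group K] (M : Subgroup K), C K → C M)
    (hquot : ∀ (K : Type u) [Group K] (M : Subgroup K) [M.Normal], C K → C (K ⧸ M))
    (hprod : ∀ (K L : Type u) [Group K] [Group L], C K → C L → C (K × L))
    (hG : C G) (H : Subgroup G) (N : Subgroup G) [N.Normal] (hNH : N ≤ H) :
    dominion C (QuotientGroup.mk '' (H : Set G) : Set (G ⧸ N)) =
      QuotientGroup.mk '' (dominion C (H : Set G)) := by
  apply Set.Subset.antisymm
  · intro q hq
    obtain ⟨a, rfl⟩ := QuotientGroup.mk_surjective q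
    refine ⟨a, fun K _ hK f g hfg => ?_, rfl⟩
    -- The identity coordinate retains the information lost on dividing by the image of `N`.
    let φ : G →* K × G := f.prod (MonoidHom.id G)
    let ψ : G →* K × G := g.prod (MonoidHom.id G)
    have hφψ : ∀ x ∈ H, φ x = ψ x := fun x hx => Prod.ext (hfg x hx) rfl
    let M : Subgroup (K × G) := N.map φ
    have hM : N.map ψ = M := by
      ext y
      constructor
      · rintro ⟨n, hn, rfl⟩
        exact ⟨n, hn, hφψ n (hNH hn)⟩
      · rintro ⟨n, hn, rfl⟩
        exact ⟨n, hn, (hφψ n (hNH hn)).symm⟩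
    let P : Subgroup (K × G) := Subgroup.normalizer (M : Set (K × G))
    let φ' : G →* P := φ.codRestrict P (φ.apply_mem_normalizer_map N)
    let ψ' : G →* P := ψ.codRestrict P fun x => by
      have h := ψ.apply_mem_normalizer_map N x
      rwa [hM] at h
    have hC : C (P ⧸ M.subgroupOf P) := hquot _ _ (hsub _ _ (hprod _ _ hK hG))
    have hφN : N ≤ (M.subgroupOf P).comap φ' := fun n hn =>
      show φ n ∈ M from ⟨n, hn, rfl⟩
    have hψN : N ≤ (M.subgroupOf P).comap ψ' := fun n hn =>
      show ψ n ∈ M from ⟨n, hn, hφψ n (hNH hn)⟩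
    have key := hq _ hC (QuotientGroup.map N _ φ' hφN) (QuotientGroup.map N _ ψ' hψN) (by
      rintro _ ⟨x, hx, rfl⟩
      exact congrArg (QuotientGroup.mk (s := M.subgroupOf P)) (Subtype.ext (hφψ x hx)))
    obtain ⟨n, -, hn⟩ := Subgroup.mem_subgroupOf.mp (QuotientGroup.eq.mp key)
    have h₁ : f n = (f a)⁻¹ * g a := congrArg Prod.fst hn
    have h₂ : n = a⁻¹ * a := congrArg Prod.snd hn
    rw [inv_mul_cancel] at h₂
    rw [h₂, map_one] at h₁
    exact inv_mul_eq_one.mp h₁.symm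
  · rintro _ ⟨a, ha, rfl⟩ K _ hK f g hfg
    exact ha K hK (f.comp (QuotientGroup.mk' N)) (g.comp (QuotientGroup.mk' N))
      fun x hx => hfg _ ⟨x, hx, rfl⟩
end

section
/- (Higman) Let p be a prime, let A be a finite p-group, and let B be a subgroup of A. Then the special amalgam [A, A; B] is strongly embeddable in a finite p-group: there exist a finite p-group M and injective group homomorphisms λ₁, λ₂ : A → M such that λ₁ and λ₂ agree on B and λ₁(A) ∩ λ₂(A) = λ₁(B). -/
universe u

/-- The special amalgam `[A,A;B]` is strongly embeddable in the finite `p`-group `M`: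
there are injective homomorphisms from the two copies of `A` into `M` agreeing on `B`,
whose images intersect exactly in the common image of `B`. -/
def StronglyEmbeddsAmalgam (p : ℕ) (A : Type u) [Group A] (B : Subgroup A)
    (M : Type u) [Group M] : Prop :=
  Finite M ∧ IsPGroup p M ∧
    ∃ l₁ l₂ : A →* M, Function.Injective l₁ ∧ Function.Injective l₂ ∧
      (∀ b ∈ B, l₁ b = l₂ b) ∧
      Set.range l₁ ∩ Set.range l₂ = l₁ '' (B : Set A)

namespace RegularWreathProduct

theorem isPGroup {p : ℕ} (hp : p.Prime) {D Q : Type*} [Group D] [Group Q] [Finite D] [Finite Q]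
    (hD : IsPGroup p D) (hQ : IsPGroup p Q) : IsPGroup p (D ≀ᵣ Q) := by
  have : Fact p.Prime := ⟨hp⟩
  obtain ⟨m, hm⟩ := IsPGroup.iff_card.mp hD
  obtain ⟨n, hn⟩ := IsPGroup.iff_card.mp hQ
  refine IsPGroup.of_card (n := m * p ^ n + n) ?_
  rw [card, hm, hn, ← pow_mul, ← pow_add]

open Classical in
/-- The function equal to `d` on the subgroup `B` and to `1` elsewhere, as an element of the base
group of the regular wreath product. -/
noncomputable def baseIndicator {D Q : Type*} [Group D] [Group Q] (B : Subgroup Q) (d : D) :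
    D ≀ᵣ Q :=
  ⟨fun x ↦ if x ∈ B then d else 1, 1⟩

/-- The stabilizer of `baseIndicator B d` in the complement `Q` is `B`. -/
theorem conj_baseIndicator_inl_eq_iff {D Q : Type*} [Group D] [Group Q] (B : Subgroup Q) {d : D}
    (hd : d ≠ 1) (a : Q) :
    MulAut.conj (baseIndicator B d) (inl a) = inl a ↔ a ∈ B := by
  rw [MulAut.conj_apply, mul_inv_eq_iff_eq_mul]
  constructor
  · intro h
    have h₁ := congrFun (congrArg left h) 1
    by_contra ha
    simp [baseIndicator, B.one_mem, ha, hd] at h₁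
  · intro ha
    ext x
    · have hx : a⁻¹ * x ∈ B ↔ x ∈ B := B.mul_mem_cancel_left (B.inv_mem ha)
      by_cases h : x ∈ B <;> simp [baseIndicator, hx, h]
    · simp [baseIndicator]

end RegularWreathProduct

/-- (Higman) A special amalgam of finite p-groups is strongly embeddable in a
finite p-group. -/
theorem higman_special_amalgam (p : ℕ) (hp : p.Prime)
    (A : Type u) [Group A] [Finite A] (hA : IsPGroup p A) (B : Subgroup A) :
    ∃ (M : Type u) (instM : Group M), @StronglyEmbeddsAmalgam p A _ B M instM := by
  open RegularWreathProduct in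
  have : Fact p.Prime := ⟨hp⟩
  let D := Multiplicative (ZMod p)
  have hD : IsPGroup p D := IsPGroup.of_card (n := 1) (by simp [D])
  obtain ⟨d, hd⟩ := exists_ne (1 : D)
  have hinl : Function.Injective (inl : A →* D ≀ᵣ A) := fun _ _ h ↦ congrArg right h
  refine ⟨D ≀ᵣ A, inferInstance, inferInstance, isPGroup hp hD hA, inl,
    (MulAut.conj (baseIndicator B d)).toMonoidHom.comp inl, hinl,
    (MulAut.conj (baseIndicator B d)).injective.comp hinl,
    fun b hb ↦ ((conj_baseIndicator_inl_eq_iff B hd b).mpr hb).symm, ?_⟩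
  ext m
  constructor
  · rintro ⟨⟨a, rfl⟩, a', h⟩
    obtain rfl : a' = a := by simpa [baseIndicator] using congrArg right h
    exact ⟨a', (conj_baseIndicator_inl_eq_iff B hd a').mp h, rfl⟩
  · rintro ⟨b, hb, rfl⟩
    exact ⟨⟨b, rfl⟩, b, (conj_baseIndicator_inl_eq_iff B hd b).mpr hb⟩
end

section
/- Let p be a prime, let G be a finite p-group, and let H be a subgroup of G. Then the dominion of H in G in the category P of all finite p-groups is trivial: dom_G^P(H) = H. -/
universe u

theorem IsPGroup.semidirectProduct {p : ℕ} [Fact p.Prime] {N G : Type*} [Group N] [Group G]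
    [Finite N] [Finite G] (hN : IsPGroup p N) (hG : IsPGroup p G) (φ : G →* MulAut N) :
    IsPGroup p (N ⋊[φ] G) := by
  obtain ⟨m, hm⟩ := IsPGroup.iff_card.mp hN
  obtain ⟨n, hn⟩ := IsPGroup.iff_card.mp hG
  exact IsPGroup.of_card (n := m + n) (by rw [SemidirectProduct.card, hm, hn, pow_add])

theorem SemidirectProduct.conj_inl_inr_eq_iff {N G : Type*} [Group N] [Group G]
    (φ : G →* MulAut N) (n : N) (g : G) :
    MulAut.conj (inl n : N ⋊[φ] G) (inr g) = inr g ↔ φ g n = n := by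
  rw [MulAut.conj_apply, mul_inv_eq_iff_eq_mul, ← inl_inj (φ := φ), inl_aut,
    map_inv, mul_inv_eq_iff_eq_mul, eq_comm]

/-- The indicator function of the trivial coset is fixed by exactly the elements of `H`. -/
theorem mulAutArrow_mulSingle_eq_iff {G M : Type*} [Group G] [Group M] (H : Subgroup G)
    [DecidableEq (G ⧸ H)] {m : M} (hm : m ≠ 1) (g : G) :
    mulAutArrow g (Pi.mulSingle ((1 : G) : G ⧸ H) m : G ⧸ H → M) =
      Pi.mulSingle ((1 : G) : G ⧸ H) m ↔ g ∈ H := by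
  have key (x : G ⧸ H) : mulAutArrow g (Pi.mulSingle ((1 : G) : G ⧸ H) m : G ⧸ H → M) x =
      (Pi.mulSingle ((1 : G) : G ⧸ H) m : G ⧸ H → M) (g⁻¹ • x) := rfl
  have hmem : g • ((1 : G) : G ⧸ H) = ((1 : G) : G ⧸ H) ↔ g ∈ H := by
    rw [← MulAction.mem_stabilizer_iff, MulAction.stabilizer_quotient]
  rw [← hmem]
  constructor
  · intro h
    by_contra hne
    have h1 := congrFun h (g • ((1 : G) : G ⧸ H))
    rw [key, inv_smul_smul, Pi.mulSingle_eq_same, Pi.mulSingle_eq_of_ne hne] at h1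
    exact hm h1
  · intro h
    ext x
    rw [key]
    simp only [Pi.mulSingle_apply, inv_smul_eq_iff, h]

/-- Dominions of subgroups of finite p-groups are trivial in the class of all
finite p-groups. -/
theorem dominion_trivial_pGroups (p : ℕ) (hp : p.Prime)
    (G : Type u) [Group G] [Finite G] (hG : IsPGroup p G) (H : Subgroup G) :
    dominion (fun (K : Type u) [Group K] => Finite K ∧ IsPGroup p K) (H : Set G) =
      (H : Set G) := by
  classical
  have : Fact p.Prime := ⟨hp⟩
  refine Set.Subset.antisymm (fun a ha => ?_) (fun a ha K _ _ f g hfg => hfg a ha)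
  let N := (G ⧸ H) → Multiplicative (ZMod p)
  let φ : G →* MulAut N := mulAutArrow
  have hfinite : Finite (N ⋊[φ] G) := .of_equiv _ SemidirectProduct.equivProd.symm
  have hN : IsPGroup p N := IsPGroup.of_card (n := Nat.card (G ⧸ H)) (by
    simp [N, Nat.card_fun])
  have hm : Multiplicative.ofAdd (1 : ZMod p) ≠ 1 := by simp
  let δ : N := Pi.mulSingle ((1 : G) : G ⧸ H) (Multiplicative.ofAdd (1 : ZMod p))
  have fixed_iff (g : G) : MulAut.conj (SemidirectProduct.inl δ : N ⋊[φ] G)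
      (SemidirectProduct.inr g) = SemidirectProduct.inr g ↔ g ∈ H :=
    (SemidirectProduct.conj_inl_inr_eq_iff φ δ g).trans (mulAutArrow_mulSingle_eq_iff H hm g)
  exact (fixed_iff a).mp (ha (N ⋊[φ] G) ⟨hfinite, hN.semidirectProduct hG φ⟩
    ((MulAut.conj (SemidirectProduct.inl δ : N ⋊[φ] G)).toMonoidHom.comp SemidirectProduct.inr)
    SemidirectProduct.inr fun x hx => (fixed_iff x).mpr hx)
end

section
/- Let G be a finite nilpotent group and let H be a subgroup of G. Then the dominion of H in G in the category Nil of all nilpotent groups is trivial: dom_G^Nil(H) = H. -/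
universe u

open scoped Function in
/-- A subgroup of a finite product of groups of pairwise coprime exponents is a box: an element
whose coordinates all lie in the coordinate projections of `H` lies in `H`. -/
theorem Subgroup.mem_of_forall_mem_map_eval {ι : Type*} [Finite ι] {A : ι → Type*}
    [∀ i, Group (A i)] {n : ι → ℕ} (hn : Pairwise (Nat.Coprime on n))
    (hA : ∀ i (x : A i), x ^ n i = 1) {H : Subgroup (∀ i, A i)} {x : ∀ i, A i}
    (hx : ∀ i, x i ∈ H.map (Pi.evalMonoidHom A i)) : x ∈ H := by
  classical
  cases nonempty_fintype ι
  refine Subgroup.pi_mem_of_mulSingle_mem x fun i => ?_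
  obtain ⟨h, hH, hi⟩ := hx i
  have hi : h i = x i := hi
  have hcop : (n i).Coprime (∏ j ∈ Finset.univ.erase i, n j) :=
    Nat.Coprime.prod_right fun j hj => hn (Finset.ne_of_mem_erase hj).symm
  obtain ⟨e, he₁, he₀⟩ := Nat.chineseRemainder hcop 1 0
  suffices Pi.mulSingle i (x i) = h ^ e from this ▸ H.pow_mem hH e
  ext j
  rw [Pi.pow_apply]
  by_cases hj : j = i
  · subst hj
    rw [Pi.mulSingle_eq_same, ← hi]
    have hmod : e ≡ 1 [MOD orderOf (h j)] := he₁.of_dvd (orderOf_dvd_of_pow_eq_one (hA j _))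
    rw [pow_eq_pow_iff_modEq.mpr hmod, pow_one]
  · rw [Pi.mulSingle_eq_of_ne hj]
    have hdvd : n j ∣ e :=
      (Finset.dvd_prod_of_mem n (Finset.mem_erase.mpr ⟨hj, Finset.mem_univ j⟩)).trans
        (Nat.modEq_zero_iff_dvd.mp he₀)
    exact (orderOf_dvd_iff_pow_eq_one.mp ((orderOf_dvd_of_pow_eq_one (hA j _)).trans hdvd)).symm

/-- Every subgroup of a finite `p`-group is the equalizer of two homomorphisms into a
nilpotent group, namely the permutational wreath product of `ZMod p` along the cosets. -/
theorem IsPGroup.exists_isNilpotent_eq_iff_mem {p : ℕ} [Fact p.Prime] {P : Type u} [Group P]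
    [Finite P] (hP : IsPGroup p P) (H : Subgroup P) :
    ∃ (K : Type u) (_ : Group K), Group.IsNilpotent K ∧
      ∃ f g : P →* K, ∀ x, f x = g x ↔ x ∈ H := by
  classical
  let A := P ⧸ H → Multiplicative (ZMod p)
  let φ : P →* MulAut A := mulAutArrow
  have hcardA : Nat.card A = p ^ Nat.card (P ⧸ H) := by
    simp [A, Nat.card_fun, Nat.card_eq_fintype_card]
  obtain ⟨k, hk⟩ := IsPGroup.iff_card.mp hP
  have : Finite (A ⋊[φ] P) := Finite.of_equiv _ SemidirectProduct.equivProd.symm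
  have hK : IsPGroup p (A ⋊[φ] P) :=
    IsPGroup.of_card (n := Nat.card (P ⧸ H) + k) (by
      rw [SemidirectProduct.card, hcardA, hk, pow_add])
  let δ : A := Pi.mulSingle ((1 : P) : P ⧸ H) (Multiplicative.ofAdd 1)
  refine ⟨A ⋊[φ] P, inferInstance, hK.isNilpotent, SemidirectProduct.inr,
    (MulAut.conj (SemidirectProduct.inl δ)).toMonoidHom.comp SemidirectProduct.inr, fun x => ?_⟩
  have hfix : φ x δ = δ ↔ x ∈ H := by
    have happ (q : P ⧸ H) : φ x δ q = δ (x⁻¹ • q) := rfl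
    have hδ (q : P ⧸ H) :
        δ q = if q = ((1 : P) : P ⧸ H) then Multiplicative.ofAdd 1 else 1 :=
      Pi.mulSingle_apply _ _ _
    constructor
    · intro h
      by_contra hx
      have hne : x⁻¹ • ((1 : P) : P ⧸ H) ≠ ((1 : P) : P ⧸ H) := fun h1 => hx <| by
        rw [MulAction.Quotient.smul_coe, QuotientGroup.eq] at h1
        simpa using h1
      have h1 := congrFun h ((1 : P) : P ⧸ H)
      rw [happ, hδ, hδ, if_neg hne, if_pos rfl] at h1
      exact one_ne_zero (α := ZMod p) (Multiplicative.ofAdd.injective h1.symm)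
    · intro hx
      have hx1 : x • ((1 : P) : P ⧸ H) = ((1 : P) : P ⧸ H) := by
        rw [MulAction.Quotient.smul_coe, QuotientGroup.eq]
        simpa using hx
      funext q
      simp only [happ, hδ, inv_smul_eq_iff, hx1]
  rw [← hfix, ← SemidirectProduct.inl_inj (φ := φ), SemidirectProduct.inl_aut, map_inv,
    mul_inv_eq_iff_eq_mul]
  change _ = SemidirectProduct.inl δ * SemidirectProduct.inr x * (SemidirectProduct.inl δ)⁻¹ ↔ _
  rw [eq_mul_inv_iff_mul_eq]

/-- Dominions of subgroups of finite nilpotent groups are trivial in the class of all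
nilpotent groups. -/
theorem dominion_trivial_finite_nilpotent
    (G : Type u) [Group G] [Finite G] (hG : Group.IsNilpotent G) (H : Subgroup G) :
    dominion (fun (K : Type u) [Group K] => Group.IsNilpotent K) (H : Set G) =
      (H : Set G) := by
  refine Set.Subset.antisymm (fun a ha => ?_) fun a ha K _ _ f g hfg => hfg a ha
  obtain ⟨e⟩ := (Group.isNilpotent_of_finite_tfae (G := G)).out 0 4 |>.mp hG
  suffices e.symm a ∈ H.map e.symm.toMonoidHom by
    obtain ⟨h, hH, hh⟩ := this
    exact e.symm.injective hh ▸ hH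
  have hprime (p : (Nat.card G).primeFactors) : Fact (p : ℕ).Prime :=
    ⟨Nat.prime_of_mem_primeFactors p.2⟩
  have hexp (p : (Nat.card G).primeFactors) (x : ∀ P : Sylow p G, (P : Subgroup G)) :
      x ^ ((p : ℕ) ^ (Nat.card G).factorization p) = 1 := by
    ext P : 1
    rw [Pi.pow_apply, Pi.one_apply, ← P.card_eq_multiplicity]
    exact pow_card_eq_one'
  refine Subgroup.mem_of_forall_mem_map_eval
    (n := fun p : (Nat.card G).primeFactors => (p : ℕ) ^ (Nat.card G).factorization p)
    (fun p q hpq => Nat.Coprime.pow _ _ <|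
      (Nat.coprime_primes (hprime p).out (hprime q).out).mpr (Subtype.coe_injective.ne hpq))
    hexp fun p => ?_
  have hP : IsPGroup p (∀ P : Sylow p G, (P : Subgroup G)) := fun x => ⟨_, hexp p x⟩
  let π : G →* (∀ P : Sylow p G, (P : Subgroup G)) :=
    (Pi.evalMonoidHom _ p).comp e.symm.toMonoidHom
  obtain ⟨K, _, hK, f, g, hfg⟩ := hP.exists_isNilpotent_eq_iff_mem (H.map π)
  have hmem : π a ∈ H.map π := (hfg _).mp <|
    ha K hK (f.comp π) (g.comp π) fun x hx => (hfg _).mpr (Subgroup.mem_map_of_mem π hx)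
  rw [Subgroup.map_map]
  exact hmem
end

section
/- Every subgroup of a finitely generated nilpotent group is closed in the profinite topology: if G is a finitely generated nilpotent group, H is a subgroup of G, and x ∈ G with x ∉ H, then there exists a normal subgroup N of G such that the quotient G/N is finite and x ∉ HN. -/
universe u

open Subgroup in
/-- If a finitely generated group has torsion centre, then so does its quotient by the centre. -/
theorem isTorsion_center_quotient_center {G : Type*} [Group G] (hfg : Group.FG G)
    (h : ∀ z ∈ center G, IsOfFinOrder z) :
    ∀ z ∈ center (G ⧸ center G), IsOfFinOrder z := by
  intro z hz
  obtain ⟨a, rfl⟩ := QuotientGroup.mk_surjective z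
  have hcomm : ∀ g : G, ∃ k, 0 < k ∧ Commute (a ^ k) g := by
    intro g
    have hc : a * g * a⁻¹ * g⁻¹ ∈ center G := by
      rw [← QuotientGroup.eq_one_iff]
      have := mem_center_iff.1 hz (g : G ⧸ center G)
      simp only [QuotientGroup.mk_mul, QuotientGroup.mk_inv]
      rw [← this]
      group
    obtain ⟨k, hk, hk1⟩ := isOfFinOrder_iff_pow_eq_one.1 (h _ hc)
    refine ⟨k, hk, ?_⟩
    set c := a * g * a⁻¹ * g⁻¹ with hcdef
    have hconj : a * g = c * g * a := by rw [hcdef]; group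
    have hpow : ∀ n : ℕ, a ^ n * g = c ^ n * g * a ^ n := by
      intro n
      induction n with
      | zero => simp
      | succ n ih =>
        have hca : a * c ^ n = c ^ n * a := mem_center_iff.1 (pow_mem hc n) a
        calc a ^ (n + 1) * g = a * (a ^ n * g) := by rw [pow_succ', mul_assoc]
          _ = a * c ^ n * g * a ^ n := by rw [ih]; simp only [mul_assoc]
          _ = c ^ n * (a * g) * a ^ n := by rw [hca]; simp only [mul_assoc]
          _ = c ^ (n + 1) * g * a ^ (n + 1) := by
            rw [hconj, pow_succ, pow_succ']; simp only [mul_assoc]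
    have := hpow k
    rwa [hk1, one_mul] at this
  choose k hk hka using hcomm
  obtain ⟨_, S, -, hS⟩ := Group.fg_iff'.1 hfg
  refine isOfFinOrder_iff_pow_eq_one.2 ⟨∏ g ∈ S, k g, Finset.prod_pos fun g _ => hk g, ?_⟩
  rw [← QuotientGroup.mk_pow, QuotientGroup.eq_one_iff]
  have hle : closure (S : Set G) ≤ centralizer {a ^ ∏ g ∈ S, k g} := by
    rw [closure_le]
    intro g hg
    obtain ⟨m, hm⟩ := Finset.dvd_prod_of_mem k (Finset.mem_coe.1 hg)
    rw [SetLike.mem_coe, mem_centralizer_singleton_iff, hm, pow_mul]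
    exact ((hka g).pow_left m).symm
  rw [hS] at hle
  exact mem_center_iff.2 fun g => mem_centralizer_singleton_iff.1 (hle (mem_top g))

open scoped IsMulCommutative in
/-- A finitely generated nilpotent group with torsion centre is finite. -/
theorem finite_of_fg_of_isTorsion_center {G : Type*} [Group G] [Group.IsNilpotent G]
    (hfg : Group.FG G) (h : ∀ z ∈ Subgroup.center G, IsOfFinOrder z) : Finite G := by
  revert hfg h
  refine Group.nilpotent_center_quotient_ind (P := fun G _ _ => Group.FG G →
    (∀ z ∈ Subgroup.center G, IsOfFinOrder z) → Finite G) G ?_ ?_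
  · intro G _ _ _ _
    infer_instance
  · intro G _ _ ih hfg h
    have hfin : Finite (G ⧸ Subgroup.center G) :=
      ih inferInstance (isTorsion_center_quotient_center hfg h)
    have : (Subgroup.center G).FiniteIndex := Subgroup.finiteIndex_of_finite_quotient
    have : Group.FG (Subgroup.center G) := inferInstance
    have : Finite (Subgroup.center G) := CommGroup.finite_of_fg_isMulTorsion _ fun z =>
      Submonoid.isOfFinOrder_coe.1 (h z z.2)
    exact Finite.of_subgroup_quotient (Subgroup.center G)

/-- If `M` has trivial normal core and every strictly larger subgroup contains a fixed element
outside `M`, then the centre is torsion. -/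
theorem isTorsion_center_of_normalCore_eq_bot {G : Type*} [Group G] {M : Subgroup G}
    (hcore : M.normalCore = ⊥) {x : G} (hx : x ∉ M) (hM : ∀ K, M < K → x ∈ K) :
    ∀ z ∈ Subgroup.center G, IsOfFinOrder z := by
  intro z hz
  by_contra hinf
  have hinj : Function.Injective fun n : ℤ => z ^ n := injective_zpow_iff_not_isOfFinOrder.2 hinf
  have hcen : ∀ n : ℤ, z ^ n ∈ Subgroup.center G := fun n => zpow_mem hz n
  have hzM : ∀ n : ℤ, z ^ n ∈ M → n = 0 := by
    intro n hn
    have hmem : z ^ n ∈ M.normalCore := fun g => by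
      rwa [Subgroup.mem_center_iff.1 (hcen n) g, mul_inv_cancel_right]
    rw [hcore, Subgroup.mem_bot] at hmem
    exact hinj (by simpa using hmem)
  have hdecomp : ∀ n : ℤ, n ≠ 0 → ∃ m ∈ M, ∃ b : ℤ, m * z ^ (n * b) = x := by
    intro n hn
    have : (Subgroup.zpowers (z ^ n)).Normal := by
      refine ⟨fun y hy g => ?_⟩
      have hyc : y ∈ Subgroup.center G :=
        (Subgroup.zpowers_le.2 (hcen n)) hy
      rwa [Subgroup.mem_center_iff.1 hyc g, mul_inv_cancel_right]
    have hlt : M < M ⊔ Subgroup.zpowers (z ^ n) :=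
      lt_of_le_of_ne le_sup_left fun h =>
        hn (hzM n (h ▸ Subgroup.mem_sup_right (Subgroup.mem_zpowers _)))
    obtain ⟨m, hm, y, hy, rfl⟩ := Subgroup.mem_sup_of_normal_right.1 (hM _ hlt)
    obtain ⟨b, rfl⟩ := Subgroup.mem_zpowers_iff.1 hy
    exact ⟨m, hm, b, by rw [zpow_mul]⟩
  obtain ⟨m, hm, a, hma⟩ := hdecomp 1 one_ne_zero
  rw [one_mul] at hma
  have ha : a ≠ 0 := by
    rintro rfl
    exact hx (by simpa [← hma] using hm)
  obtain ⟨m', hm', b, hmb⟩ := hdecomp (2 * a) (by simpa using ha)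
  have hdiff : z ^ (a - 2 * a * b) = m⁻¹ * m' := by
    rw [zpow_sub, mul_inv_eq_iff_eq_mul, mul_assoc, hmb, ← hma, inv_mul_cancel_left]
  have h0 := hzM _ (hdiff ▸ mul_mem (inv_mem hm) hm')
  have h1 : a * (1 - 2 * b) = 0 := by linarith
  rcases mul_eq_zero.1 h1 with h | h
  · exact ha h
  · omega

/-- The image of a subgroup modulo its normal core has trivial normal core. -/
theorem normalCore_map_mk'_normalCore {G : Type*} [Group G] (M : Subgroup G) :
    (M.map (QuotientGroup.mk' M.normalCore)).normalCore = ⊥ := by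
  have hsurj := QuotientGroup.mk'_surjective M.normalCore
  have hcm : (M.map (QuotientGroup.mk' M.normalCore)).comap (QuotientGroup.mk' M.normalCore) = M :=
    Subgroup.comap_map_eq_self (by simpa using M.normalCore_le)
  rw [← Subgroup.map_comap_eq_self_of_surjective hsurj
    (M.map (QuotientGroup.mk' M.normalCore)).normalCore, Subgroup.map_eq_bot_iff,
    QuotientGroup.ker_mk', Subgroup.normal_le_normalCore]
  exact (Subgroup.comap_mono (Subgroup.normalCore_le _)).trans hcm.le

/-- In a finitely generated nilpotent group, a subgroup that is maximal among those avoiding a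
given element has a normal core of finite index. -/
theorem finite_quotient_normalCore {G : Type*} [Group G] [Group.IsNilpotent G]
    (hfg : Group.FG G) {M : Subgroup G} {x : G} (hx : x ∉ M) (hM : ∀ K, M < K → x ∈ K) :
    Finite (G ⧸ M.normalCore) := by
  have hsurj := QuotientGroup.mk'_surjective M.normalCore
  have hcm : (M.map (QuotientGroup.mk' M.normalCore)).comap (QuotientGroup.mk' M.normalCore) = M :=
    Subgroup.comap_map_eq_self (by simpa using M.normalCore_le)
  refine finite_of_fg_of_isTorsion_center inferInstance
    (isTorsion_center_of_normalCore_eq_bot (normalCore_map_mk'_normalCore M)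
      (x := QuotientGroup.mk' M.normalCore x) ?_ fun K hK => ?_)
  · rwa [← Subgroup.mem_comap, hcm]
  · rw [← Subgroup.mem_comap]
    refine hM _ ?_
    exact hcm.symm.trans_lt ((Subgroup.comap_lt_comap_of_surjective hsurj).2 hK)

/-- A subgroup avoiding `x` is contained in a maximal subgroup avoiding `x`. -/
theorem exists_maximal_subgroup_notMem {G : Type*} [Group G] {H : Subgroup G} {x : G}
    (hx : x ∉ H) : ∃ M : Subgroup G, H ≤ M ∧ x ∉ M ∧ ∀ K, M < K → x ∈ K := by
  obtain ⟨M, hHM, hM⟩ := zorn_le_nonempty₀ {K : Subgroup G | x ∉ K} (fun c hc hchain K hK => by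
    refine ⟨sSup c, fun hmem => ?_, fun L hL => le_sSup hL⟩
    obtain ⟨L, hL, hxL⟩ := (Subgroup.mem_sSup_of_directedOn ⟨K, hK⟩ hchain.directedOn).1 hmem
    exact hc hL hxL) H hx
  exact ⟨M, hHM, hM.prop, fun K hK => not_not.1 fun h => hM.not_prop_of_gt hK h⟩

/-- (Mal'cev) Every subgroup of a finitely generated nilpotent group is closed in the
profinite topology: any element outside the subgroup is separated from it by a normal
subgroup of finite index. -/
theorem subgroup_closed_in_profinite_topology
    (G : Type u) [Group G] (hfg : Group.FG G) (hnil : Group.IsNilpotent G)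
    (H : Subgroup G) (x : G) (hx : x ∉ H) :
    ∃ N : Subgroup G, N.Normal ∧ Finite (G ⧸ N) ∧ x ∉ H ⊔ N := by
  obtain ⟨M, hHM, hxM, hM⟩ := exists_maximal_subgroup_notMem hx
  exact ⟨M.normalCore, inferInstance, finite_quotient_normalCore hfg hxM hM,
    fun h => hxM (sup_le hHM M.normalCore_le h)⟩
end

section
/- Let G be a finitely generated nilpotent group and let H be a subgroup of G. Then the dominion of H in G in the category Nil of all nilpotent groups is trivial: dom_G^Nil(H) = H. -/
universe u

open Subgroup

theorem exists_maximal_normal_notMem_sup {G : Type*} [Group G] {H : Subgroup G} {a : G}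
    (ha : a ∉ H) :
    ∃ N : Subgroup G, N.Normal ∧ a ∉ H ⊔ N ∧ ∀ M : Subgroup G, M.Normal → N < M → a ∈ H ⊔ M := by
  obtain ⟨N, -, hN⟩ := zorn_le_nonempty₀ {N : Subgroup G | N.Normal ∧ a ∉ H ⊔ N}
    (fun c hc hchain y hy => by
      have hnormal : (sSup c).Normal := sSup_normal c fun K hK => (hc hK).1
      refine ⟨sSup c, ⟨hnormal, fun h => ?_⟩, fun K hK => le_sSup hK⟩
      obtain ⟨x, hx, z, hz, rfl⟩ := mem_sup_of_normal_right.1 h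
      obtain ⟨K, hK, hzK⟩ := (mem_sSup_of_directedOn ⟨y, hy⟩ hchain.directedOn).1 hz
      exact (hc hK).2 (mul_mem_sup hx hzK))
    ⊥ ⟨inferInstance, by simpa using ha⟩
  refine ⟨N, hN.prop.1, hN.prop.2, fun M hM hlt => ?_⟩
  by_contra h
  exact hlt.not_ge (hN.le_of_ge ⟨hM, h⟩ hlt.le)

theorem zpowers_normal_of_mem_center {G : Type*} [Group G] {z : G} (hz : z ∈ center G) :
    (zpowers z).Normal :=
  ⟨fun x hx g => by
    have hxc : x ∈ center G := (zpowers_le.2 hz) hx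
    rwa [mem_center_iff.1 hxc g, mul_inv_cancel_right]⟩

/-- If `a ∉ H`, but `a` lies in the join of `H` with every nontrivial normal subgroup, then `H`
contains no nontrivial central element. -/
theorem eq_one_of_mem_center_of_mem {G : Type*} [Group G] {H : Subgroup G} {a : G} (ha : a ∉ H)
    (hmin : ∀ M : Subgroup G, M.Normal → M ≠ ⊥ → a ∈ H ⊔ M) {z : G} (hz : z ∈ center G)
    (hzH : z ∈ H) : z = 1 := by
  by_contra h
  have := hmin (zpowers z) (zpowers_normal_of_mem_center hz) (by simpa using h)
  rw [sup_eq_left.2 (by simpa using hzH)] at this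
  exact ha this

theorem exists_mul_zpow_of_mem_center {G : Type*} [Group G] {H : Subgroup G} {a : G}
    (hmin : ∀ M : Subgroup G, M.Normal → M ≠ ⊥ → a ∈ H ⊔ M) {z : G} (hz : z ∈ center G)
    (hz1 : z ≠ 1) : ∃ x ∈ H, ∃ i : ℤ, x * z ^ i = a := by
  have := zpowers_normal_of_mem_center hz
  obtain ⟨x, hx, y, hy, h⟩ := mem_sup_of_normal_right.1
    (hmin (zpowers z) this (by simpa using hz1))
  obtain ⟨i, rfl⟩ := mem_zpowers_iff.1 hy
  exact ⟨x, hx, i, h⟩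

theorem isOfFinOrder_of_mem_center {G : Type*} [Group G] {H : Subgroup G} {a : G} (ha : a ∉ H)
    (hmin : ∀ M : Subgroup G, M.Normal → M ≠ ⊥ → a ∈ H ⊔ M) {z : G} (hz : z ∈ center G) :
    IsOfFinOrder z := by
  by_contra hinf
  have hinj := injective_zpow_iff_not_isOfFinOrder.2 hinf
  have hz1 : z ≠ 1 := by rintro rfl; exact hinf IsOfFinOrder.one
  obtain ⟨x, hx, i, hxi⟩ := exists_mul_zpow_of_mem_center hmin hz hz1
  have hdvd : ∀ n : ℤ, n ≠ 0 → n ∣ i := fun n hn => by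
    obtain ⟨y, hy, j, hyj⟩ := exists_mul_zpow_of_mem_center hmin (zpow_mem hz n)
      (fun h => hn (hinj (by simpa using h)))
    have hmem : z ^ (i - n * j) ∈ H := by
      have : z ^ (i - n * j) = x⁻¹ * y := by
        rw [zpow_sub, zpow_mul, eq_inv_mul_iff_mul_eq, ← mul_assoc, hxi, ← hyj,
          mul_inv_cancel_right]
      exact this ▸ mul_mem (inv_mem hx) hy
    have h1 := eq_one_of_mem_center_of_mem ha hmin (zpow_mem hz _) hmem
    have h0 : i - n * j = 0 := hinj (by simpa using h1)
    exact ⟨j, by lia⟩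
  have hi : i = 0 := by
    have := hdvd (2 * |i| + 1) (by positivity)
    refine Int.eq_zero_of_abs_lt_dvd this ?_
    have := abs_nonneg i
    lia
  subst hi
  rw [zpow_zero, mul_one] at hxi
  exact ha (hxi ▸ hx)

theorem prime_orderOf_eq_of_mem_center {G : Type*} [Group G] {H : Subgroup G} {a : G} (ha : a ∉ H)
    (hmin : ∀ M : Subgroup G, M.Normal → M ≠ ⊥ → a ∈ H ⊔ M) {z w : G} (hz : z ∈ center G)
    (hw : w ∈ center G) (hzp : (orderOf z).Prime) (hwp : (orderOf w).Prime) :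
    orderOf z = orderOf w := by
  by_contra hne
  have hz1 : z ≠ 1 := by rintro rfl; simp [Nat.not_prime_one] at hzp
  have hw1 : w ≠ 1 := by rintro rfl; simp [Nat.not_prime_one] at hwp
  obtain ⟨x, hx, i, hxi⟩ := exists_mul_zpow_of_mem_center hmin hz hz1
  obtain ⟨y, hy, j, hyj⟩ := exists_mul_zpow_of_mem_center hmin hw hw1
  have hmem : z ^ i * w ^ (-j) ∈ H := by
    have : z ^ i * w ^ (-j) = x⁻¹ * y := by
      rw [zpow_neg, eq_inv_mul_iff_mul_eq, ← mul_assoc, hxi, ← hyj, mul_inv_cancel_right]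
    exact this ▸ mul_mem (inv_mem hx) hy
  have h1 := eq_one_of_mem_center_of_mem ha hmin
    (mul_mem (zpow_mem hz _) (zpow_mem hw _)) hmem
  have h2 : z ^ i = w ^ j := by simpa [mul_inv_eq_one] using h1
  have hcop : (orderOf z).Coprime (orderOf w) := (Nat.coprime_primes hzp hwp).2 hne
  have h3 : z ^ i = 1 := by
    rw [← orderOf_eq_one_iff]
    refine Nat.eq_one_of_dvd_coprimes hcop (orderOf_dvd_of_mem_zpowers ⟨i, rfl⟩) ?_
    exact h2 ▸ orderOf_dvd_of_mem_zpowers ⟨j, rfl⟩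
  rw [h3, mul_one] at hxi
  exact ha (hxi ▸ hx)

/-- If `a ∉ H`, but `a` lies in the join of `H` with every nontrivial normal subgroup, then the
center is a `p`-group for some prime `p`. -/
theorem exists_isPGroup_center {G : Type*} [Group G] {H : Subgroup G} {a : G} (ha : a ∉ H)
    (hmin : ∀ M : Subgroup G, M.Normal → M ≠ ⊥ → a ∈ H ⊔ M) :
    ∃ p : ℕ, p.Prime ∧ IsPGroup p (center G) := by
  have hdiv : ∀ z ∈ center G, ∀ q : ℕ, q.Prime → q ∣ orderOf z →
      ∃ w ∈ center G, orderOf w = q := fun z hz q _ hqz =>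
    ⟨z ^ (orderOf z / q), pow_mem hz _, orderOf_pow_orderOf_div
      (isOfFinOrder_of_mem_center ha hmin hz).orderOf_pos.ne' hqz⟩
  by_cases h : ∃ w ∈ center G, (orderOf w).Prime
  · obtain ⟨w, hw, hwp⟩ := h
    refine ⟨orderOf w, hwp, fun z => ?_⟩
    have hz := Nat.eq_prime_pow_of_unique_prime_dvd (p := orderOf w)
      (isOfFinOrder_of_mem_center ha hmin z.2).orderOf_pos.ne' (fun {q} hq hqz => by
        obtain ⟨v, hv, rfl⟩ := hdiv z z.2 q hq hqz
        exact prime_orderOf_eq_of_mem_center ha hmin hv hw hq hwp)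
    exact ⟨_, Subtype.ext (by rw [coe_pow, ← hz, pow_orderOf_eq_one, coe_one])⟩
  · refine ⟨2, Nat.prime_two, fun z => ⟨0, Subtype.ext ?_⟩⟩
    have : orderOf (z : G) = 1 := by
      by_contra hne
      obtain ⟨q, hq, hqz⟩ := Nat.exists_prime_and_dvd hne
      obtain ⟨w, hw, rfl⟩ := hdiv z z.2 q hq hqz
      exact h ⟨w, hw, hq⟩
    rw [coe_pow, orderOf_eq_one_iff.1 this, one_pow, coe_one]

theorem mul_pow_of_mul_eq_mul_mul_center {G : Type*} [Group G] {s x c : G} (hc : c ∈ center G)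
    (h : s * x = x * s * c) (n : ℕ) : s * x ^ n = x ^ n * s * c ^ n := by
  have h' : MulAut.conj s x = x * c := by
    rw [MulAut.conj_apply, h, mul_assoc x s c, mem_center_iff.1 hc s, ← mul_assoc,
      mul_inv_cancel_right]
  have hcn := congrArg (· ^ n) h'
  simp only [(show Commute x c from mem_center_iff.1 hc x).mul_pow, ← map_pow] at hcn
  rw [MulAut.conj_apply, mul_inv_eq_iff_eq_mul] at hcn
  rw [hcn, mul_assoc, mul_assoc, mem_center_iff.1 (pow_mem hc n) s]

theorem isPGroup_center_quotient_center {G : Type*} [Group G] [Group.FG G] {p : ℕ}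
    (hp : IsPGroup p (center G)) : IsPGroup p (center (G ⧸ center G)) := by
  obtain ⟨S, hS⟩ := Group.fg_def.1 ‹Group.FG G›
  rintro ⟨x, hx⟩
  obtain ⟨x, rfl⟩ := QuotientGroup.mk_surjective x
  have hcomm : ∀ s : G, ∃ k : ℕ, ∃ c ∈ center G, s * x = x * s * c ∧ c ^ p ^ k = 1 := fun s => by
    have hc : (x * s)⁻¹ * (s * x) ∈ center G := by
      rw [← QuotientGroup.eq]
      exact (mem_center_iff.1 hx (s : G ⧸ center G)).symm
    obtain ⟨k, hk⟩ := hp ⟨_, hc⟩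
    exact ⟨k, _, hc, by group, by simpa [Subtype.ext_iff] using hk⟩
  choose k c hc hsx hck using hcomm
  refine ⟨∑ s ∈ S, k s, Subtype.ext ?_⟩
  rw [coe_pow, coe_one]
  change ((x ^ _ : G) : G ⧸ center G) = 1
  rw [QuotientGroup.eq_one_iff, ← centralizer_univ, ← coe_top, ← hS, centralizer_closure,
    mem_centralizer_iff]
  intro s hs
  rw [mul_pow_of_mul_eq_mul_mul_center (hc s) (hsx s)]
  have : c s ^ p ^ ∑ s ∈ S, k s = 1 := by
    obtain ⟨m, hm⟩ := pow_dvd_pow p (Finset.single_le_sum (f := k) (fun _ _ => Nat.zero_le _) hs)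
    rw [hm, pow_mul, hck, one_pow]
  rw [this, mul_one]

theorem isPGroup_of_isPGroup_center {G : Type*} [Group G] [Group.IsNilpotent G] (hG : Group.FG G)
    {p : ℕ} (hp : IsPGroup p (center G)) : IsPGroup p G := by
  revert hG hp
  refine Group.nilpotent_center_quotient_ind (P := fun G _ _ => Group.FG G → IsPGroup p (center G) →
    IsPGroup p G) G (fun G _ _ _ _ x => ⟨0, Subsingleton.elim _ _⟩) fun G _ _ ih hG hp x => ?_
  obtain ⟨k, hk⟩ := ih inferInstance (isPGroup_center_quotient_center hp) x
  have hk' : x ^ p ^ k ∈ center G := (QuotientGroup.eq_one_iff _).1 hk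
  obtain ⟨l, hl⟩ := hp ⟨_, hk'⟩
  exact ⟨k + l, by simpa [Subtype.ext_iff, ← pow_mul, ← pow_add] using hl⟩

theorem finiteIndex_derivedSeries {G : Type*} [Group G] [Group.FG G] (ht : IsMulTorsion G)
    (n : ℕ) : (derivedSeries G n).FiniteIndex := by
  induction n with
  | zero => rw [derivedSeries_zero]; infer_instance
  | succ n ih =>
    have : Group.FG (Abelianization (derivedSeries G n)) :=
      Group.fg_of_surjective (f := Abelianization.of) (QuotientGroup.mk'_surjective _)
    have htorsion : IsMulTorsion (Abelianization (derivedSeries G n)) :=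
      (ht.subgroup _).of_surjective (f := Abelianization.of) (QuotientGroup.mk'_surjective _)
    have : Finite (derivedSeries G n ⧸ _root_.commutator (derivedSeries G n)) :=
      CommGroup.finite_of_fg_isMulTorsion (Abelianization (derivedSeries G n)) htorsion
    have h : (_root_.commutator (derivedSeries G n)).FiniteIndex := finiteIndex_of_finite_quotient
    rw [derivedSeries_succ, ← map_subtype_commutator]
    refine ⟨?_⟩
    rw [index_map_subtype]
    exact mul_ne_zero h.index_ne_zero ih.index_ne_zero

theorem finite_of_fg_of_isSolvable {G : Type*} [Group G] [Group.FG G] [Group.IsSolvable G]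
    (ht : IsMulTorsion G) : Finite G := by
  obtain ⟨n, hn⟩ := Group.IsSolvable.solvable (G := G)
  have := finiteIndex_derivedSeries ht n
  rw [hn] at this
  exact Nat.finite_of_card_ne_zero (by simpa using this.index_ne_zero)

/-- A subgroup of a finite `p`-group is the equalizer of two homomorphisms to a nilpotent group:
the canonical embedding in a permutational wreath product with `ZMod p`, and a conjugate of it. -/
theorem exists_isNilpotent_separating {G : Type u} [Group G] [Finite G] {p : ℕ} (hp : p.Prime)
    (hG : IsPGroup p G) (H : Subgroup G) :
    ∃ (K : Type u) (_ : Group K) (f g : G →* K), Group.IsNilpotent K ∧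
      ∀ x, f x = g x ↔ x ∈ H := by
  classical
  have : Fact p.Prime := ⟨hp⟩
  let φ : G →* MulAut (G ⧸ H → Multiplicative (ZMod p)) := mulAutArrow
  let K := (G ⧸ H → Multiplicative (ZMod p)) ⋊[φ] G
  let δ : G ⧸ H → Multiplicative (ZMod p) := Pi.mulSingle (1 : G) (.ofAdd 1)
  have hδ1 : δ (1 : G) = .ofAdd 1 := Pi.mulSingle_eq_same _ _
  have hδ : ∀ q, q ≠ ((1 : G) : G ⧸ H) → δ q = 1 := fun q hq => Pi.mulSingle_eq_of_ne hq _
  have hfin : Finite K := .of_equiv _ SemidirectProduct.equivProd.symm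
  have hK : IsPGroup p K := by
    obtain ⟨n, hn⟩ := hG.exists_card_eq
    refine IsPGroup.of_card (n := Nat.card (G ⧸ H) + n) ?_
    rw [SemidirectProduct.card, hn, Nat.card_fun, pow_add]
    simp
  have hfix : ∀ x, φ x δ = δ ↔ x ∈ H := by
    refine fun x => ⟨fun h => ?_, fun h => ?_⟩
    · by_contra hx
      have h1 : δ (x⁻¹ • ((1 : G) : G ⧸ H)) = δ ((1 : G) : G ⧸ H) := congrFun h _
      have hne : x⁻¹ • ((1 : G) : G ⧸ H) ≠ ((1 : G) : G ⧸ H) := fun h => hx <| by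
        rw [MulAction.Quotient.smul_mk, eq_comm, QuotientGroup.eq] at h
        simpa using h
      rw [hδ1, hδ _ hne] at h1
      exact zero_ne_one (α := ZMod p) h1
    · funext q
      change δ (x⁻¹ • q) = δ q
      have hfix : x⁻¹ • ((1 : G) : G ⧸ H) = ((1 : G) : G ⧸ H) := by
        rw [MulAction.Quotient.smul_mk, eq_comm, QuotientGroup.eq]
        simpa using h
      by_cases hq : q = ((1 : G) : G ⧸ H)
      · rw [hq, hfix]
      · rw [hδ _ hq, hδ]
        exact fun hq' => hq (smul_left_cancel x⁻¹ (hq'.trans hfix.symm))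
  refine ⟨K, inferInstance, SemidirectProduct.inr,
    (MulAut.conj (SemidirectProduct.inl δ)).toMonoidHom.comp SemidirectProduct.inr,
    hK.isNilpotent, fun x => ?_⟩
  rw [← hfix, ← (SemidirectProduct.inl_injective (φ := φ)).eq_iff, SemidirectProduct.inl_aut]
  simp only [MonoidHom.comp_apply, MulEquiv.coe_toMonoidHom, MulAut.conj_apply]
  rw [map_inv, eq_mul_inv_iff_mul_eq, mul_inv_eq_iff_eq_mul]

/-- Dominions of subgroups of finitely generated nilpotent groups are trivial in the
class of all nilpotent groups. -/
theorem dominion_trivial_fg_nilpotent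
    (G : Type u) [Group G] (hfg : Group.FG G) (hnil : Group.IsNilpotent G)
    (H : Subgroup G) :
    dominion (fun (K : Type u) [Group K] => Group.IsNilpotent K) (H : Set G) =
      (H : Set G) := by
  refine Set.Subset.antisymm (fun a ha => ?_) fun a ha K _ _ f g h => h a ha
  by_contra haH
  obtain ⟨N, hN, haN, hmax⟩ := exists_maximal_normal_notMem_sup (H := H) haH
  let π := QuotientGroup.mk' N
  have hcomap (L : Subgroup G) : (L.map π).comap π = L ⊔ N := by
    rw [comap_map_eq, QuotientGroup.ker_mk']
  have haπ : π a ∉ H.map π := by rwa [← mem_comap, hcomap]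
  have hmin : ∀ M : Subgroup (G ⧸ N), M.Normal → M ≠ ⊥ → π a ∈ H.map π ⊔ M := by
    intro M hM hM1
    have hsurj : Function.Surjective π := QuotientGroup.mk'_surjective N
    rw [← map_comap_eq_self_of_surjective hsurj M, ← Subgroup.map_sup]
    refine mem_map_of_mem π (hmax _ (hM.comap π) (lt_of_le_of_ne ?_ fun h => hM1 ?_))
    · simpa [π] using ker_le_comap π M
    · rw [← map_comap_eq_self_of_surjective hsurj M, ← h, Subgroup.map_eq_bot_iff, QuotientGroup.ker_mk']
  obtain ⟨p, hp, hcenter⟩ := exists_isPGroup_center haπ hmin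
  have hP : IsPGroup p (G ⧸ N) := isPGroup_of_isPGroup_center inferInstance hcenter
  have hfin : Finite (G ⧸ N) := finite_of_fg_of_isSolvable fun x => by
    obtain ⟨k, hk⟩ := hP x
    exact isOfFinOrder_iff_pow_eq_one.2 ⟨p ^ k, pow_pos hp.pos k, hk⟩
  obtain ⟨K, _, f, g, hK, hfg⟩ := exists_isNilpotent_separating hp hP (H.map π)
  exact haπ ((hfg _).1 (ha K hK (f.comp π) (g.comp π) fun x hx =>
    (hfg _).2 (mem_map_of_mem π hx)))
end

section
/- Let G be a group, N a normal subgroup of G, and H a subgroup of G. Then there exists a transversal (set-theoretic section) τ : G/N → G of the canonical projection π : G → G/N such that: (1) τ(N) = e, i.e., τ sends the identity coset to the identity; and (2) for every h ∈ H and every y ∈ G, there exists h' ∈ H such that τ(yh⁻¹N) = τ(yN)·h'⁻¹. -/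
universe u

/-- For a normal subgroup N of G and a subgroup H of G, there is a transversal
τ : G/N → G of the canonical projection which sends the identity coset to the identity
and is compatible with the right action of H: for all h ∈ H and y ∈ G there is h' ∈ H
with τ(yh⁻¹N) = τ(yN)h'⁻¹. -/
theorem exists_transversal_compatible_with_subgroup
    (G : Type u) [Group G] (N : Subgroup G) [N.Normal] (H : Subgroup G) :
    ∃ τ : G ⧸ N → G,
      (∀ c : G ⧸ N, (QuotientGroup.mk (τ c) : G ⧸ N) = c) ∧
      (τ (1 : G ⧸ N) = 1) ∧
      (∀ h ∈ H, ∀ y : G, ∃ h' ∈ H,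
        τ (QuotientGroup.mk (y * h⁻¹)) = τ (QuotientGroup.mk y) * h'⁻¹) := by
  let K : Subgroup (G ⧸ N) := H.map (QuotientGroup.mk' N)
  have exists_rep : ∀ a : (G ⧸ N) ⧸ K,
      ∃ g : G, ((g : G ⧸ N) : (G ⧸ N) ⧸ K) = a ∧ (a = ((1 : G ⧸ N) : (G ⧸ N) ⧸ K) → g = 1) := by
    intro a
    by_cases ha : a = ((1 : G ⧸ N) : (G ⧸ N) ⧸ K)
    · exact ⟨1, ha.symm, fun _ => rfl⟩
    · obtain ⟨c, rfl⟩ := QuotientGroup.mk_surjective a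
      obtain ⟨g, rfl⟩ := QuotientGroup.mk_surjective c
      exact ⟨g, rfl, fun h => absurd h ha⟩
  have exists_lift : ∀ k : G ⧸ N, ∃ g : G, (k ∈ K → g ∈ H ∧ (g : G ⧸ N) = k) ∧ (k = 1 → g = 1) := by
    intro k
    by_cases hk : k = 1
    · exact ⟨1, fun _ => ⟨H.one_mem, hk.symm⟩, fun _ => rfl⟩
    · by_cases hK : k ∈ K
      · obtain ⟨g, hg, rfl⟩ := hK
        exact ⟨g, fun _ => ⟨hg, rfl⟩, fun h => absurd h hk⟩
      · exact ⟨1, fun h => absurd h hK, fun _ => rfl⟩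
  choose σ hσ hσ_one using exists_rep
  choose t ht ht_one using exists_lift
  have mem_K : ∀ c : G ⧸ N, (σ (c : (G ⧸ N) ⧸ K) : G ⧸ N)⁻¹ * c ∈ K :=
    fun c => QuotientGroup.eq.mp (hσ c)
  refine ⟨fun c => σ (c : (G ⧸ N) ⧸ K) * t ((σ (c : (G ⧸ N) ⧸ K) : G ⧸ N)⁻¹ * c), ?_, ?_, ?_⟩
  · intro c
    rw [QuotientGroup.mk_mul, (ht _ (mem_K c)).2, mul_inv_cancel_left]
  · have h_one : σ ((1 : G ⧸ N) : (G ⧸ N) ⧸ K) = 1 := hσ_one _ rfl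
    simp only [h_one, QuotientGroup.mk_one, inv_one, mul_one, one_mul]
    exact ht_one 1 rfl
  · intro h hh y
    have same_coset : (((y * h⁻¹ : G) : G ⧸ N) : (G ⧸ N) ⧸ K) = ((y : G ⧸ N) : (G ⧸ N) ⧸ K) := by
      refine QuotientGroup.eq.mpr ⟨h, hh, ?_⟩
      simp
    have h₁ := (ht _ (mem_K (y * h⁻¹ : G))).1
    have h₂ := (ht _ (mem_K y)).1
    rw [same_coset] at h₁
    refine ⟨_, H.mul_mem (H.inv_mem h₁) h₂, ?_⟩
    simp only [same_coset]
    group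
end
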